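/- For the L-helper JSCC problem with bandwidth ratio τ > 0, the optimal rate satisfies R(τ) = inf_{k≥1} R_k. -/

import Mathlib

open Filter Real

noncomputable section

namespace DHT

/-- Real-valued indicator of a proposition. -/
def ind (P : Prop) : ℝ := by classical exact if P then 1 else 0

/-- `p` is a probability mass function on the finite type `α`. -/
def IsPMF {α : Type*} [Fintype α] (p : α → ℝ) : Prop :=
  (∀ a, 0 ≤ p a) ∧ ∑ a, p a = 1

/-- `f` is a stochastic kernel: every row is a pmf. -/
def IsKernel {α β : Type*} [Fintype β] (f : α → β → ℝ) : Prop :=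
  ∀ a, (∀ b, 0 ≤ f a b) ∧ ∑ b, f a b = 1

/-- Pushforward of a pmf along a map. -/
def pushf {α β : Type*} [Fintype α] (p : α → ℝ) (f : α → β) : β → ℝ :=
  fun b => ∑ a, ind (f a = b) * p a

/-- Probability of a set under a pmf. -/
def probIn {α : Type*} [Fintype α] (p : α → ℝ) (A : Set α) : ℝ :=
  ∑ a, ind (a ∈ A) * p a

/-- Shannon entropy, in bits. -/
def entropy {α : Type*} [Fintype α] (p : α → ℝ) : ℝ :=
  -∑ a, p a * Real.logb 2 (p a)

/-- Kullback–Leibler divergence, in bits. -/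
def klDiv {α : Type*} [Fintype α] (p q : α → ℝ) : ℝ :=
  ∑ a, p a * Real.logb 2 (p a / q a)

/-- Conditional entropy `H(α | β)` of a joint pmf on `α × β`, in bits. -/
def condEntropy {α β : Type*} [Fintype α] [Fintype β] (p : α × β → ℝ) : ℝ :=
  -∑ x : α × β, p x * Real.logb 2 (p x / ∑ a, p (a, x.2))

/-- Mutual information `I(α;β)`, in bits. -/
def mutualInfo {α β : Type*} [Fintype α] [Fintype β] (p : α × β → ℝ) : ℝ :=
  ∑ x : α × β, p x * Real.logb 2 (p x / ((∑ b, p (x.1, b)) * (∑ a, p (a, x.2))))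

/-- Conditional mutual information `I(α;β|γ)`, in bits. -/
def condMI {α β γ : Type*} [Fintype α] [Fintype β] [Fintype γ] (p : α × β × γ → ℝ) : ℝ :=
  ∑ x : α × β × γ, p x * Real.logb 2
    (p x * (∑ a, ∑ b, p (a, b, x.2.2)) /
      ((∑ b, p (x.1, b, x.2.2)) * (∑ a, p (a, x.2.1, x.2.2))))

/-- Markov chain `α − β − γ`: the first and third components are conditionally
independent given the middle one. -/
def MarkovChain {α β γ : Type*} [Fintype α] [Fintype γ] (p : α × β × γ → ℝ) : Prop :=
  ∀ a b c, p (a, b, c) * (∑ a', ∑ c', p (a', b, c')) =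
    (∑ c', p (a, b, c')) * (∑ a', p (a', b, c))

/-- Shannon capacity of a discrete memoryless channel, in bits per use. -/
def capacity {X Y : Type*} [Fintype X] [Fintype Y] (Ch : X → Y → ℝ) : ℝ :=
  sSup {c | ∃ q : X → ℝ, IsPMF q ∧ c = mutualInfo (fun xy : X × Y => q xy.1 * Ch xy.1 xy.2)}

/-- Empirical distribution (type) of a length-`j` sequence. -/
def empDist {α : Type*} [Fintype α] {j : ℕ} (w : Fin j → α) : α → ℝ :=
  fun a => (∑ i, ind (w i = a)) / j

/-- δ-typicality: the empirical distribution is within δ of `p` in every coordinate. -/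
def IsTypical {α : Type*} [Fintype α] (p : α → ℝ) (δ : ℝ) {j : ℕ} (w : Fin j → α) : Prop :=
  ∀ a, |empDist w a - p a| ≤ δ

section System

variable {L : ℕ} {U X Y : Fin L → Type} {V Z : Type}
variable [∀ l, Fintype (U l)] [∀ l, Fintype (X l)] [∀ l, Fintype (Y l)]
variable [Fintype V] [Fintype Z]

/-- Joint pmf of the channel outputs `(Y₁ⁿ,…,Y_Lⁿ)`, `V^k` and `Z^k` induced by `k` i.i.d.
copies of the source `R`, the stochastic encoders `f` and the memoryless channels `Ch`. -/
def inducedDist (R : (((l : Fin L) → U l) × V × Z) → ℝ)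
    (Ch : (l : Fin L) → X l → Y l → ℝ) (k n : ℕ)
    (f : (l : Fin L) → (Fin k → U l) → (Fin n → X l) → ℝ) :
    (((l : Fin L) → Fin n → Y l) × (Fin k → V) × (Fin k → Z)) → ℝ :=
  fun yvz =>
    ∑ u : (l : Fin L) → Fin k → U l, ∑ x : (l : Fin L) → Fin n → X l,
      (∏ i : Fin k, R ((fun l => u l i), yvz.2.1 i, yvz.2.2 i)) *
        ((∏ l, f l (u l) (x l)) * ∏ l, ∏ j : Fin n, Ch l (x l j) (yvz.1 l j))

/-- `P` and `Q` have the same single-variable marginals. -/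
def SameMarginals (P Q : (((l : Fin L) → U l) × V × Z) → ℝ) : Prop :=
  (∀ (l : Fin L) (a : U l),
      (∑ x : ((l : Fin L) → U l) × V × Z, ind (x.1 l = a) * P x) =
        ∑ x : ((l : Fin L) → U l) × V × Z, ind (x.1 l = a) * Q x) ∧
  (∀ v : V, (∑ x : ((l : Fin L) → U l) × V × Z, ind (x.2.1 = v) * P x) =
      ∑ x : ((l : Fin L) → U l) × V × Z, ind (x.2.1 = v) * Q x) ∧
  (∀ z : Z, (∑ x : ((l : Fin L) → U l) × V × Z, ind (x.2.2 = z) * P x) =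
      ∑ x : ((l : Fin L) → U l) × V × Z, ind (x.2.2 = z) * Q x)

/-- Testing against conditional independence: `Q = P_{U_𝓛|Z} P_{V|Z} P_Z`. -/
def IsTACI (P Q : (((l : Fin L) → U l) × V × Z) → ℝ) : Prop :=
  ∀ x : ((l : Fin L) → U l) × V × Z,
    Q x = (∑ v : V, P (x.1, v, x.2.2)) * (∑ u : (l : Fin L) → U l, P (u, x.2.1, x.2.2)) /
      (∑ u : (l : Fin L) → U l, ∑ v : V, P (u, v, x.2.2))

/-- Optimal type-2 error probability `β(k,τ,ε)`. -/
def beta (P Q : (((l : Fin L) → U l) × V × Z) → ℝ)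
    (Ch : (l : Fin L) → X l → Y l → ℝ) (τ ε : ℝ) (k : ℕ) : ℝ :=
  sInf {b | ∃ n : ℕ, (n : ℝ) ≤ τ * k ∧
    ∃ f : (l : Fin L) → (Fin k → U l) → (Fin n → X l) → ℝ,
      (∀ l, IsKernel (f l)) ∧
      ∃ A : Set (((l : Fin L) → Fin n → Y l) × (Fin k → V) × (Fin k → Z)),
        probIn (inducedDist P Ch k n f) Aᶜ ≤ ε ∧
        b = probIn (inducedDist Q Ch k n f) A}

/-- `θ(k,τ)`. -/
def thetaK (P Q : (((l : Fin L) → U l) × V × Z) → ℝ)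
    (Ch : (l : Fin L) → X l → Y l → ℝ) (τ : ℝ) (k : ℕ) : ℝ :=
  sSup {d | ∃ n : ℕ, (n : ℝ) ≤ τ * k ∧
    ∃ f : (l : Fin L) → (Fin k → U l) → (Fin n → X l) → ℝ,
      (∀ l, IsKernel (f l)) ∧
      d = klDiv (inducedDist P Ch k n f) (inducedDist Q Ch k n f) / k}

/-- `θ(τ) = sup_{k ≥ 1} θ(k,τ)`. -/
def theta (P Q : (((l : Fin L) → U l) × V × Z) → ℝ)
    (Ch : (l : Fin L) → X l → Y l → ℝ) (τ : ℝ) : ℝ :=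
  sSup {d | ∃ k : ℕ, 1 ≤ k ∧ d = thetaK P Q Ch τ k}

/-- Optimal type-2 error exponent `κ(τ,ε)`. -/
def kappa (P Q : (((l : Fin L) → U l) × V × Z) → ℝ)
    (Ch : (l : Fin L) → X l → Y l → ℝ) (τ ε : ℝ) : ℝ :=
  sSup {κ : ℝ | 0 ≤ κ ∧ ∀ δ : ℝ, 0 < δ →
    Filter.limsup (fun k : ℕ => Real.logb 2 (beta P Q Ch τ ε k) / k) Filter.atTop ≤ -(κ - δ)}

/-- `I(V^k; Y₁ⁿ,…,Y_Lⁿ | Z^k)` of the induced distribution. -/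
def miVY (P : (((l : Fin L) → U l) × V × Z) → ℝ)
    (Ch : (l : Fin L) → X l → Y l → ℝ) (k n : ℕ)
    (f : (l : Fin L) → (Fin k → U l) → (Fin n → X l) → ℝ) : ℝ :=
  condMI (fun x : (Fin k → V) × ((l : Fin L) → Fin n → Y l) × (Fin k → Z) =>
    inducedDist P Ch k n f (x.2.1, x.1, x.2.2))

/-- `H(V^k | Y₁ⁿ,…,Y_Lⁿ, Z^k)` of the induced distribution. -/
def condEntV (P : (((l : Fin L) → U l) × V × Z) → ℝ)
    (Ch : (l : Fin L) → X l → Y l → ℝ) (k n : ℕ)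
    (f : (l : Fin L) → (Fin k → U l) → (Fin n → X l) → ℝ) : ℝ :=
  condEntropy (fun x : (Fin k → V) × (((l : Fin L) → Fin n → Y l) × (Fin k → Z)) =>
    inducedDist P Ch k n f (x.2.1, x.1, x.2.2))

/-- Probability of correct decoding in the `L`-helper JSCC problem. -/
def probCorrect (P : (((l : Fin L) → U l) × V × Z) → ℝ)
    (Ch : (l : Fin L) → X l → Y l → ℝ) (k n m : ℕ)
    (f : (l : Fin L) → (Fin k → U l) → (Fin n → X l) → ℝ)
    (φ : (Fin k → V) → Fin m)
    (g : Fin m × ((l : Fin L) → Fin n → Y l) × (Fin k → Z) → (Fin k → V)) : ℝ :=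
  ∑ w : ((l : Fin L) → Fin n → Y l) × (Fin k → V) × (Fin k → Z),
    ind (g (φ w.2.1, w.1, w.2.2) = w.2.1) * inducedDist P Ch k n f w

/-- Achievability of rate `R` in the `L`-helper JSCC problem with bandwidth ratio `τ`. -/
def JSCCAchievable (P : (((l : Fin L) → U l) × V × Z) → ℝ)
    (Ch : (l : Fin L) → X l → Y l → ℝ) (τ R : ℝ) : Prop :=
  ∀ lam : ℝ, 0 < lam → lam ≤ 1 →
    ∃ (nseq mseq : ℕ → ℕ) (δ : ℕ → ℝ)
      (f : (k : ℕ) → (l : Fin L) → (Fin k → U l) → (Fin (nseq k) → X l) → ℝ)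
      (φ : (k : ℕ) → (Fin k → V) → Fin (mseq k))
      (g : (k : ℕ) → Fin (mseq k) × ((l : Fin L) → Fin (nseq k) → Y l) × (Fin k → Z) →
        (Fin k → V)),
      (∀ k, 0 ≤ δ k) ∧ Filter.Tendsto δ Filter.atTop (nhds 0) ∧
      ∀ k : ℕ, 1 ≤ k →
        (nseq k : ℝ) ≤ τ * k ∧ 1 ≤ mseq k ∧ (∀ l, IsKernel (f k l)) ∧
        1 - lam ≤ probCorrect P Ch k (nseq k) (mseq k) (f k) (φ k) (g k) ∧
        Real.logb 2 (mseq k) / k ≤ R + δ k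

/-- Optimal rate `R(τ)` of the `L`-helper JSCC problem. -/
def Rjscc (P : (((l : Fin L) → U l) × V × Z) → ℝ)
    (Ch : (l : Fin L) → X l → Y l → ℝ) (τ : ℝ) : ℝ :=
  sInf {R | JSCCAchievable P Ch τ R}

/-- `R_k`: infimum of `H(V^k|Y^n,Z^k)/k` over block lengths `n ≤ τk` and encoders. -/
def Rk (P : (((l : Fin L) → U l) × V × Z) → ℝ)
    (Ch : (l : Fin L) → X l → Y l → ℝ) (τ : ℝ) (k : ℕ) : ℝ :=
  sInf {r | ∃ n : ℕ, (n : ℝ) ≤ τ * k ∧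
    ∃ f : (l : Fin L) → (Fin k → U l) → (Fin n → X l) → ℝ,
      (∀ l, IsKernel (f l)) ∧ r = condEntV P Ch k n f / k}

end System

section SingleObserver

variable {Uu Xx Yy V Z : Type}
variable [Fintype Uu] [Fintype Xx] [Fintype Yy] [Fintype V] [Fintype Z]

/-- Single-observer induced joint pmf of `(Yⁿ, V^k, Z^k)`. -/
def inducedDist1 (R : Uu × V × Z → ℝ) (Ch : Xx → Yy → ℝ) (k n : ℕ)
    (f : (Fin k → Uu) → (Fin n → Xx) → ℝ) :
    ((Fin n → Yy) × (Fin k → V) × (Fin k → Z)) → ℝ :=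
  fun yvz => ∑ u : Fin k → Uu, ∑ x : Fin n → Xx,
    (∏ i : Fin k, R (u i, yvz.2.1 i, yvz.2.2 i)) *
      (f u x * ∏ j : Fin n, Ch (x j) (yvz.1 j))

end SingleObserver

section Aux

variable {Uu V Z Wt : Type} [Fintype Uu] [Fintype V] [Fintype Z] [Fintype Wt]

/-- Markov chain `(Z,V) − U − W` for a joint pmf on `(U × V × Z) × W`. -/
def MarkovZVUW (J : (Uu × V × Z) × Wt → ℝ) : Prop :=
  MarkovChain (fun x : (Z × V) × Uu × Wt => J ((x.2.1, x.1.2, x.1.1), x.2.2))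

/-- `I(U;W|Z)` for a joint pmf on `(U × V × Z) × W`. -/
def miUW_Z (J : (Uu × V × Z) × Wt → ℝ) : ℝ :=
  condMI (fun x : Uu × Wt × Z => ∑ v, J ((x.1, v, x.2.2), x.2.1))

/-- `I(V;W|Z)` for a joint pmf on `(U × V × Z) × W`. -/
def miVW_Z (J : (Uu × V × Z) × Wt → ℝ) : ℝ :=
  condMI (fun x : V × Wt × Z => ∑ u, J ((u, x.1, x.2.2), x.2.1))

/-- `I(U;W|V,Z)` for a joint pmf on `(U × V × Z) × W`. -/
def miUW_VZ (J : (Uu × V × Z) × Wt → ℝ) : ℝ :=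
  condMI (fun x : Uu × Wt × (V × Z) => J ((x.1, x.2.2.1, x.2.2.2), x.2.1))

/-- `H(V|W,Z)` for a joint pmf on `(U × V × Z) × W`. -/
def entV_WZ (J : (Uu × V × Z) × Wt → ℝ) : ℝ :=
  condEntropy (fun x : V × (Wt × Z) => ∑ u, J ((u, x.1, x.2.2), x.2.1))

/-- `H(V|Z)` for a joint pmf on `U × V × Z`. -/
def entV_Z (P : Uu × V × Z → ℝ) : ℝ :=
  condEntropy (fun x : V × Z => ∑ u, P (u, x.1, x.2))

end Aux

end DHT

namespace DHT

section Indicator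

theorem ind_of_true {p : Prop} (h : p) : ind p = 1 := by
  unfold ind; exact if_pos h

theorem ind_of_false {p : Prop} (h : ¬ p) : ind p = 0 := by
  unfold ind; exact if_neg h

theorem ind_nonneg (p : Prop) : 0 ≤ ind p := by
  by_cases h : p
  · rw [ind_of_true h]; exact zero_le_one
  · rw [ind_of_false h]

end Indicator

section OneShot

theorem le_marginal {A B : Type*} [Fintype A] {p : A × B → ℝ} (hp : ∀ x, 0 ≤ p x) (x : A × B) :
    p x ≤ ∑ a, p (a, x.2) :=
  Finset.single_le_sum (f := fun a => p (a, x.2)) (fun _ _ => hp _) (Finset.mem_univ x.1)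

theorem sum_ind_collision {A : Type*} [Fintype A] [DecidableEq A] (M : ℕ) [NeZero M]
    {a b : A} (hab : a ≠ b) :
    ∑ φ : A → Fin M, ind (φ b = φ a) = (Fintype.card (A → Fin M) : ℝ) / M := by
  have hM : (M : ℝ) ≠ 0 := by exact_mod_cast NeZero.ne M
  have hshift : ∀ c : Fin M,
      ∑ φ : A → Fin M, ind (φ b + c = φ a) = ∑ φ : A → Fin M, ind (φ b = φ a) := by
    intro c
    refine Fintype.sum_equiv
      (Equiv.piCongrRight fun i : A => if i = b then Equiv.addRight c else Equiv.refl (Fin M)) _ _ ?_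
    intro φ
    simp [hab]
  have htotal : ∑ c : Fin M, ∑ φ : A → Fin M, ind (φ b + c = φ a) =
      Fintype.card (A → Fin M) := by
    rw [Finset.sum_comm]
    have : ∀ φ : A → Fin M, ∑ c : Fin M, ind (φ b + c = φ a) = 1 := by
      intro φ
      rw [Finset.sum_eq_single (φ a - φ b)]
      · exact ind_of_true (by abel)
      · intro c _ hc
        exact ind_of_false fun h => hc (by rw [← h]; abel)
      · simp
    simp [this]
  rw [Finset.sum_congr rfl fun c _ => hshift c] at htotal
  rw [eq_div_iff hM, ← htotal]
  simp [mul_comm]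

/-- One-shot random binning for source coding with side information. -/
theorem exists_binning {A B : Type*} [Fintype A] [Fintype B] [Nonempty A]
    {p : A × B → ℝ} (hp : IsPMF p) {M : ℕ} (hM : 0 < M)
    {T : ℝ} (hT : 0 < T) :
    ∃ (φ : A → Fin M) (g : Fin M × B → A),
      1 - (∑ x : A × B, ind (p x * T < ∑ a, p (a, x.2)) * p x + T / M) ≤
        ∑ x : A × B, ind (g (φ x.1, x.2) = x.1) * p x := by
  classical
  have : NeZero M := ⟨hM.ne'⟩
  have hM' : (0 : ℝ) < M := by exact_mod_cast hM
  set S : A → B → Prop := fun a b => 0 < ∑ a', p (a', b) ∧ ∑ a', p (a', b) ≤ p (a, b) * T with hS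
  have hcard : ∀ b, ∑ a, ind (S a b) ≤ T := by
    intro b
    rcases (Finset.sum_nonneg fun a _ => hp.1 (a, b) :
      (0 : ℝ) ≤ ∑ a', p (a', b)).eq_or_lt with h0 | h0
    · rw [Finset.sum_eq_zero]
      · exact hT.le
      · intro a _
        exact ind_of_false fun h => h.1.ne h0
    · refine le_of_mul_le_mul_right ?_ h0
      rw [Finset.sum_mul, Finset.mul_sum]
      refine Finset.sum_le_sum fun a _ => ?_
      by_cases h : S a b
      · rw [ind_of_true h, one_mul, mul_comm]; exact h.2
      · rw [ind_of_false h, zero_mul]; exact mul_nonneg hT.le (hp.1 _)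
  set E : (A → Fin M) → ℝ := fun φ =>
    ∑ x : A × B, p x * ∑ a, ind (a ≠ x.1 ∧ S a x.2 ∧ φ x.1 = φ a) with hE
  have hcoll : ∀ (x : A × B) (a : A),
      ∑ φ : A → Fin M, ind (a ≠ x.1 ∧ S a x.2 ∧ φ x.1 = φ a) ≤
        ind (S a x.2) * ((Fintype.card (A → Fin M) : ℝ) / M) := by
    intro x a
    by_cases h : a ≠ x.1 ∧ S a x.2
    · rw [ind_of_true h.2, one_mul, ← sum_ind_collision M h.1]
      refine Finset.sum_le_sum fun φ _ => ?_
      by_cases h' : φ x.1 = φ a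
      · rw [ind_of_true h', ind_of_true ⟨h.1, h.2, h'⟩]
      · rw [ind_of_false h', ind_of_false fun hc => h' hc.2.2]
    · rw [Finset.sum_eq_zero fun φ _ => ind_of_false fun h' => h ⟨h'.1, h'.2.1⟩]
      exact mul_nonneg (ind_nonneg _) (by positivity)
  have hsum : ∑ φ, E φ ≤ ∑ _φ : A → Fin M, T / M := by
    calc ∑ φ, E φ
        = ∑ x : A × B, p x * ∑ a, ∑ φ : A → Fin M, ind (a ≠ x.1 ∧ S a x.2 ∧ φ x.1 = φ a) := by
          rw [hE, Finset.sum_comm]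
          refine Finset.sum_congr rfl fun x _ => ?_
          rw [← Finset.mul_sum, Finset.sum_comm]
      _ ≤ ∑ x : A × B, p x * (T * ((Fintype.card (A → Fin M) : ℝ) / M)) := by
          refine Finset.sum_le_sum fun x _ => mul_le_mul_of_nonneg_left ?_ (hp.1 x)
          refine (Finset.sum_le_sum fun a _ => hcoll x a).trans ?_
          rw [← Finset.sum_mul]
          exact mul_le_mul_of_nonneg_right (hcard _) (by positivity)
      _ = ∑ _φ : A → Fin M, T / M := by
          rw [← Finset.sum_mul, hp.2, Finset.sum_const, nsmul_eq_mul, Finset.card_univ]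
          ring
  obtain ⟨φ, -, hφ⟩ := Finset.exists_le_of_sum_le Finset.univ_nonempty hsum
  set g : Fin M × B → A := fun y =>
    if h : ∃ a, S a y.2 ∧ y.1 = φ a then h.choose else Classical.arbitrary A with hg
  refine ⟨φ, g, ?_⟩
  have hpt : ∀ x : A × B,
      p x ≤ ind (p x * T < ∑ a, p (a, x.2)) * p x +
        p x * ∑ a, ind (a ≠ x.1 ∧ S a x.2 ∧ φ x.1 = φ a) +
        ind (g (φ x.1, x.2) = x.1) * p x := by
    intro x
    have h1 : 0 ≤ ind (p x * T < ∑ a, p (a, x.2)) * p x := mul_nonneg (ind_nonneg _) (hp.1 x)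
    have h2 : 0 ≤ p x * ∑ a, ind (a ≠ x.1 ∧ S a x.2 ∧ φ x.1 = φ a) :=
      mul_nonneg (hp.1 x) (Finset.sum_nonneg fun a _ => ind_nonneg _)
    have h3 : 0 ≤ ind (g (φ x.1, x.2) = x.1) * p x := mul_nonneg (ind_nonneg _) (hp.1 x)
    rcases (hp.1 x).eq_or_lt with h0 | h0
    · linarith
    by_cases hT' : p x * T < ∑ a, p (a, x.2)
    · rw [ind_of_true hT'] at h1 ⊢; linarith
    by_cases hgx : g (φ x.1, x.2) = x.1
    · rw [ind_of_true hgx] at h3 ⊢; linarith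
    have hSx : S x.1 x.2 := ⟨h0.trans_le (le_marginal hp.1 x), not_lt.1 hT'⟩
    have hex : ∃ a, S a x.2 ∧ φ x.1 = φ a := ⟨x.1, hSx, rfl⟩
    have hgval : g (φ x.1, x.2) = hex.choose := dif_pos hex
    have hone : (1 : ℝ) ≤ ∑ a, ind (a ≠ x.1 ∧ S a x.2 ∧ φ x.1 = φ a) := by
      rw [← ind_of_true (p := hex.choose ≠ x.1 ∧ S hex.choose x.2 ∧ φ x.1 = φ hex.choose)
        ⟨hgval ▸ hgx, hex.choose_spec.1, hex.choose_spec.2⟩]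
      exact Finset.single_le_sum
        (f := fun a => ind (a ≠ x.1 ∧ S a x.2 ∧ φ x.1 = φ a))
        (fun a _ => ind_nonneg _) (Finset.mem_univ _)
    nlinarith
  have htot := Finset.sum_le_sum fun x (_ : x ∈ Finset.univ) => hpt x
  rw [hp.2, Finset.sum_add_distrib, Finset.sum_add_distrib] at htot
  have : ∑ x : A × B, p x * ∑ a, ind (a ≠ x.1 ∧ S a x.2 ∧ φ x.1 = φ a) ≤ T / M := hφ
  linarith

end OneShot

section Information

variable {A B : Type*} [Fintype A] [Fintype B]

/-- Conditional information density `-log₂ p(a|b)` of a joint pmf on `A × B`. -/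
def infoDensity (p : A × B → ℝ) (x : A × B) : ℝ :=
  -Real.logb 2 (p x / ∑ a, p (a, x.2))

/-- Variance of the conditional information density. -/
def infoVar (p : A × B → ℝ) : ℝ :=
  ∑ x, p x * (infoDensity p x - condEntropy p) ^ 2

theorem condEntropy_eq_sum_infoDensity (p : A × B → ℝ) :
    condEntropy p = ∑ x, p x * infoDensity p x := by
  simp [condEntropy, infoDensity]

theorem infoVar_nonneg {p : A × B → ℝ} (hp : ∀ x, 0 ≤ p x) : 0 ≤ infoVar p :=
  Finset.sum_nonneg fun x _ => mul_nonneg (hp x) (sq_nonneg _)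

theorem condEntropy_nonneg {p : A × B → ℝ} (hp : ∀ x, 0 ≤ p x) : 0 ≤ condEntropy p := by
  rw [condEntropy_eq_sum_infoDensity]
  refine Finset.sum_nonneg fun x _ => mul_nonneg (hp x) ?_
  rw [infoDensity, neg_nonneg]
  have h0 : 0 ≤ ∑ a, p (a, x.2) := Finset.sum_nonneg fun a _ => hp _
  exact Real.logb_nonpos one_lt_two (div_nonneg (hp x) h0) (div_le_one_of_le₀ (le_marginal hp x) h0)

theorem sum_mul_infoDensity_sub {p : A × B → ℝ} (hp : IsPMF p) :
    ∑ x, p x * (infoDensity p x - condEntropy p) = 0 := by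
  simp only [mul_sub, Finset.sum_sub_distrib, ← Finset.sum_mul, hp.2]
  rw [← condEntropy_eq_sum_infoDensity]; ring

/-- Chebyshev bound for the conditional information density. -/
theorem sum_ind_lt_le_infoVar {p : A × B → ℝ} (hp : ∀ x, 0 ≤ p x) {c t : ℝ}
    (ht : 0 < t) (hc : condEntropy p ≤ c) :
    ∑ x : A × B, ind (p x * (2 : ℝ) ^ (c + t) < ∑ a, p (a, x.2)) * p x ≤ infoVar p / t ^ 2 := by
  rw [infoVar, Finset.sum_div]
  refine Finset.sum_le_sum fun x _ => ?_
  have hnn : 0 ≤ p x * (infoDensity p x - condEntropy p) ^ 2 / t ^ 2 :=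
    div_nonneg (mul_nonneg (hp x) (sq_nonneg _)) (sq_nonneg _)
  by_cases h : p x * (2 : ℝ) ^ (c + t) < ∑ a, p (a, x.2)
  swap
  · rw [ind_of_false h, zero_mul]; exact hnn
  rcases (hp x).eq_or_lt with h0 | h0
  · rw [← h0] at hnn ⊢; simp
  rw [ind_of_true h, one_mul, le_div_iff₀ (by positivity)]
  refine mul_le_mul_of_nonneg_left ?_ (hp x)
  have hm : 0 < ∑ a, p (a, x.2) := h0.trans_le (le_marginal hp x)
  have : c + t < infoDensity p x := by
    rw [infoDensity, ← Real.logb_inv, inv_div, Real.lt_logb_iff_rpow_lt one_lt_two (by positivity),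
      lt_div_iff₀ h0, mul_comm]
    exact h
  exact pow_le_pow_left₀ ht.le (by linarith) 2

section Product

variable {A A₁ A₂ B B₁ B₂ : Type*} [Fintype A] [Fintype A₁] [Fintype A₂]
  {p : A × B → ℝ} {p₁ : A₁ × B₁ → ℝ} {p₂ : A₂ × B₂ → ℝ} {eA : A ≃ A₁ × A₂} {eB : B ≃ B₁ × B₂}

theorem infoDensity_of_product (h₁ : ∀ x, 0 ≤ p₁ x) (h₂ : ∀ x, 0 ≤ p₂ x)
    (h : ∀ a b, p (a, b) = p₁ ((eA a).1, (eB b).1) * p₂ ((eA a).2, (eB b).2))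
    (a : A) (b : B) (hpos : p (a, b) ≠ 0) :
    infoDensity p (a, b) =
      infoDensity p₁ ((eA a).1, (eB b).1) + infoDensity p₂ ((eA a).2, (eB b).2) := by
  have hm : ∑ a, p (a, b) = (∑ a, p₁ (a, (eB b).1)) * ∑ a, p₂ (a, (eB b).2) := by
    rw [Finset.sum_mul_sum, ← Fintype.sum_prod_type']
    exact Fintype.sum_equiv eA _ _ fun a => h a b
  rw [h a b] at hpos
  have hp₁ := left_ne_zero_of_mul hpos
  have hp₂ := right_ne_zero_of_mul hpos
  have hm₁ := ((h₁ _).lt_of_ne' hp₁).trans_le (le_marginal h₁ ((eA a).1, (eB b).1))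
  have hm₂ := ((h₂ _).lt_of_ne' hp₂).trans_le (le_marginal h₂ ((eA a).2, (eB b).2))
  simp only [infoDensity]
  rw [hm, h a b, mul_div_mul_comm, Real.logb_mul (div_ne_zero hp₁ hm₁.ne')
    (div_ne_zero hp₂ hm₂.ne')]
  ring

variable [Fintype B] [Fintype B₁] [Fintype B₂]

theorem sum_of_product
    (h : ∀ a b, p (a, b) = p₁ ((eA a).1, (eB b).1) * p₂ ((eA a).2, (eB b).2))
    (F : A × B → ℝ) (G : A₁ × B₁ → A₂ × B₂ → ℝ)
    (hFG : ∀ a b, p (a, b) ≠ 0 → F (a, b) = G ((eA a).1, (eB b).1) ((eA a).2, (eB b).2)) :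
    ∑ x, p x * F x = ∑ x₁, p₁ x₁ * ∑ x₂, p₂ x₂ * G x₁ x₂ := by
  simp only [Finset.mul_sum]
  rw [← Fintype.sum_prod_type']
  refine Fintype.sum_equiv ((Equiv.prodCongr eA eB).trans (Equiv.prodProdProdComm _ _ _ _)) _ _ ?_
  rintro ⟨a, b⟩
  simp only [Equiv.trans_apply, Equiv.prodCongr_apply, Prod.map_apply, Equiv.prodProdProdComm_apply]
  by_cases h0 : p (a, b) = 0
  · rw [h0, zero_mul, ← mul_assoc, ← h a b, h0, zero_mul]
  · rw [hFG a b h0, h a b, mul_assoc]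

theorem condEntropy_of_product (h₁ : IsPMF p₁) (h₂ : IsPMF p₂)
    (h : ∀ a b, p (a, b) = p₁ ((eA a).1, (eB b).1) * p₂ ((eA a).2, (eB b).2)) :
    condEntropy p = condEntropy p₁ + condEntropy p₂ := by
  rw [condEntropy_eq_sum_infoDensity p, sum_of_product h _
    (fun x₁ x₂ => infoDensity p₁ x₁ + infoDensity p₂ x₂)
    fun a b hab => infoDensity_of_product h₁.1 h₂.1 h a b hab]
  simp only [mul_add, Finset.sum_add_distrib, ← Finset.sum_mul, h₂.2, one_mul, h₁.2,
    ← condEntropy_eq_sum_infoDensity]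

theorem infoVar_of_product (h₁ : IsPMF p₁) (h₂ : IsPMF p₂)
    (h : ∀ a b, p (a, b) = p₁ ((eA a).1, (eB b).1) * p₂ ((eA a).2, (eB b).2)) :
    infoVar p = infoVar p₁ + infoVar p₂ := by
  have key := sum_of_product h (fun x => (infoDensity p x - condEntropy p) ^ 2)
    (fun x₁ x₂ => (infoDensity p₁ x₁ - condEntropy p₁) ^ 2 +
      2 * (infoDensity p₁ x₁ - condEntropy p₁) * (infoDensity p₂ x₂ - condEntropy p₂) +
      (infoDensity p₂ x₂ - condEntropy p₂) ^ 2)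
    (fun a b hab => by
      rw [infoDensity_of_product h₁.1 h₂.1 h a b hab, condEntropy_of_product h₁ h₂ h]
      ring)
  have hinner : ∀ x₁, ∑ x₂, p₂ x₂ * ((infoDensity p₁ x₁ - condEntropy p₁) ^ 2 +
      2 * (infoDensity p₁ x₁ - condEntropy p₁) * (infoDensity p₂ x₂ - condEntropy p₂) +
      (infoDensity p₂ x₂ - condEntropy p₂) ^ 2) =
      (infoDensity p₁ x₁ - condEntropy p₁) ^ 2 + infoVar p₂ := by
    intro x₁
    have h3 : ∑ x₂, p₂ x₂ * (2 * (infoDensity p₁ x₁ - condEntropy p₁) *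
        (infoDensity p₂ x₂ - condEntropy p₂)) = 0 := by
      rw [← mul_zero (2 * (infoDensity p₁ x₁ - condEntropy p₁)), ← sum_mul_infoDensity_sub h₂,
        Finset.mul_sum]
      exact Finset.sum_congr rfl fun x _ => by ring
    simp only [mul_add, Finset.sum_add_distrib, h3, ← Finset.sum_mul, h₂.2, infoVar]
    ring
  rw [infoVar, key, Finset.sum_congr rfl fun x₁ _ => by rw [hinner x₁]]
  simp only [mul_add, Finset.sum_add_distrib, ← Finset.sum_mul, h₁.2, one_mul]
  rfl

end Product

/-- Gibbs' inequality in conditional form. -/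
theorem condEntropy_le_cross {p q : A × B → ℝ} (hp : IsPMF p) (hq : ∀ x, 0 < q x)
    (hq1 : ∀ b, ∑ a, q (a, b) ≤ 1) :
    condEntropy p ≤ ∑ x, p x * -Real.logb 2 (q x) := by
  have hlog : 0 < Real.log 2 := Real.log_pos one_lt_two
  have hterm : ∀ x : A × B, p x * infoDensity p x - p x * -Real.logb 2 (q x) ≤
      (q x * ∑ a, p (a, x.2) - p x) / Real.log 2 := by
    intro x
    have hm0 : 0 ≤ ∑ a, p (a, x.2) := Finset.sum_nonneg fun a _ => hp.1 _
    rcases (hp.1 x).eq_or_lt with h0 | h0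
    · rw [← h0]
      simpa using div_nonneg (mul_nonneg (hq x).le hm0) hlog.le
    have hm : 0 < ∑ a, p (a, x.2) := h0.trans_le (le_marginal hp.1 x)
    have h1 : infoDensity p x - -Real.logb 2 (q x) =
        Real.log (q x * (∑ a, p (a, x.2)) / p x) / Real.log 2 := by
      rw [infoDensity, ← Real.logb_inv, inv_div, sub_neg_eq_add, add_comm,
        ← Real.logb_mul (hq x).ne' (by positivity), mul_div_assoc]
      rfl
    have h2 := Real.log_le_sub_one_of_pos (x := q x * (∑ a, p (a, x.2)) / p x)
      (div_pos (mul_pos (hq x) hm) h0)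
    rw [← mul_sub, h1, ← mul_div_assoc]
    refine div_le_div_of_nonneg_right ?_ hlog.le
    calc p x * Real.log (q x * (∑ a, p (a, x.2)) / p x)
        ≤ p x * (q x * (∑ a, p (a, x.2)) / p x - 1) := mul_le_mul_of_nonneg_left h2 h0.le
      _ = _ := by field_simp
  have hsum := Finset.sum_le_sum fun x (_ : x ∈ Finset.univ) => hterm x
  rw [Finset.sum_sub_distrib, ← condEntropy_eq_sum_infoDensity, ← Finset.sum_div,
    Finset.sum_sub_distrib, hp.2] at hsum
  have hle : ∑ x : A × B, q x * ∑ a, p (a, x.2) ≤ 1 := by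
    rw [← hp.2, Fintype.sum_prod_type_right, Fintype.sum_prod_type_right]
    refine Finset.sum_le_sum fun b _ => ?_
    simp only [← Finset.sum_mul]
    exact mul_le_of_le_one_left (Finset.sum_nonneg fun a _ => hp.1 _) (hq1 b)
  have := div_nonpos_of_nonpos_of_nonneg (sub_nonpos.2 hle) hlog.le
  linarith

/-- Fano's inequality for source coding with side information. -/
theorem condEntropy_le_of_code [Nonempty A] {p : A × B → ℝ} (hp : IsPMF p) {m : ℕ} (hm : 1 ≤ m)
    (φ : A → Fin m) (g : Fin m × B → A) {lam : ℝ}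
    (hg : 1 - lam ≤ ∑ x : A × B, ind (g (φ x.1, x.2) = x.1) * p x) :
    condEntropy p ≤ Real.logb 2 m + 1 + lam * Real.logb 2 (Fintype.card A) := by
  classical
  have hm0 : (0 : ℝ) < m := by exact_mod_cast hm
  have hA1 : 1 ≤ Fintype.card A := Fintype.card_pos
  have hA0 : (0 : ℝ) < Fintype.card A := by exact_mod_cast hA1
  have hlm : 0 ≤ Real.logb 2 m := Real.logb_nonneg one_lt_two (by exact_mod_cast hm)
  have hlA : 0 ≤ Real.logb 2 (Fintype.card A) :=
    Real.logb_nonneg one_lt_two (by exact_mod_cast hA1)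
  set q : A × B → ℝ := fun x =>
    ind (g (φ x.1, x.2) = x.1) * (1 / (2 * m)) + 1 / (2 * Fintype.card A) with hq
  have hqpos : ∀ x, 0 < q x := fun x =>
    add_pos_of_nonneg_of_pos (mul_nonneg (ind_nonneg _) (by positivity)) (by positivity)
  have hcount : ∀ b, ∑ a, ind (g (φ a, b) = a) ≤ m := by
    intro b
    have : ∀ a, ind (g (φ a, b) = a) ≤ ∑ c : Fin m, ind (φ a = c ∧ g (c, b) = a) := by
      intro a
      by_cases h : g (φ a, b) = a
      · rw [ind_of_true h, ← ind_of_true (p := φ a = φ a ∧ g (φ a, b) = a) ⟨rfl, h⟩]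
        exact Finset.single_le_sum (f := fun c => ind (φ a = c ∧ g (c, b) = a))
          (fun c _ => ind_nonneg _) (Finset.mem_univ _)
      · rw [ind_of_false h]
        exact Finset.sum_nonneg fun c _ => ind_nonneg _
    refine (Finset.sum_le_sum fun a _ => this a).trans ?_
    rw [Finset.sum_comm]
    have : ∀ c : Fin m, ∑ a, ind (φ a = c ∧ g (c, b) = a) ≤ 1 := by
      intro c
      rw [Finset.sum_eq_single (g (c, b))]
      · by_cases h : φ (g (c, b)) = c ∧ g (c, b) = g (c, b)
        · rw [ind_of_true h]
        · rw [ind_of_false h]; exact zero_le_one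
      · intro a _ ha
        exact ind_of_false fun h => ha h.2.symm
      · simp
    simpa using Finset.sum_le_sum fun c (_ : c ∈ Finset.univ) => this c
  have hq1 : ∀ b, ∑ a, q (a, b) ≤ 1 := by
    intro b
    simp only [hq, Finset.sum_add_distrib, ← Finset.sum_mul, Finset.sum_const, Finset.card_univ,
      nsmul_eq_mul]
    have h1 : (∑ a, ind (g (φ a, b) = a)) * (1 / (2 * m)) ≤ m * (1 / (2 * m)) :=
      mul_le_mul_of_nonneg_right (hcount b) (by positivity)
    have h2 : (m : ℝ) * (1 / (2 * m)) = 1 / 2 := by field_simp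
    have h3 : (Fintype.card A : ℝ) * (1 / (2 * Fintype.card A)) = 1 / 2 := by field_simp
    linarith
  refine (condEntropy_le_cross hp hqpos hq1).trans ?_
  have hlog2 : ∀ y : ℝ, 0 < y → -Real.logb 2 (1 / (2 * y)) = 1 + Real.logb 2 y := by
    intro y hy
    rw [← Real.logb_inv, one_div, inv_inv, Real.logb_mul two_ne_zero hy.ne',
      Real.logb_self_eq_one one_lt_two]
  have hterm : ∀ x : A × B, p x * -Real.logb 2 (q x) ≤
      p x * (1 + Real.logb 2 m + Real.logb 2 (Fintype.card A)) -
        ind (g (φ x.1, x.2) = x.1) * p x * Real.logb 2 (Fintype.card A) := by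
    intro x
    by_cases h : g (φ x.1, x.2) = x.1
    · have : 1 / (2 * (m : ℝ)) ≤ q x := by
        simp only [hq, ind_of_true h, one_mul]
        exact le_add_of_nonneg_right (by positivity)
      have := Real.logb_le_logb_of_le one_lt_two (by positivity) this
      have := hlog2 m hm0
      rw [ind_of_true h]
      nlinarith [hp.1 x]
    · have : 1 / (2 * (Fintype.card A : ℝ)) ≤ q x := by
        simp only [hq, ind_of_false h, zero_mul, zero_add, le_refl]
      have := Real.logb_le_logb_of_le one_lt_two (by positivity) this
      have := hlog2 _ hA0
      rw [ind_of_false h]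
      nlinarith [hp.1 x, mul_nonneg (hp.1 x) hlm]
  refine (Finset.sum_le_sum fun x _ => hterm x).trans ?_
  rw [Finset.sum_sub_distrib, ← Finset.sum_mul, hp.2, ← Finset.sum_mul]
  nlinarith

end Information

/-- Splitting a family of length-`(a + b)` sequences into its initial and final parts. -/
def splitEquiv {ι : Type*} (W : ι → Type*) (a b : ℕ) :
    ((l : ι) → Fin (a + b) → W l) ≃ ((l : ι) → Fin a → W l) × ((l : ι) → Fin b → W l) where
  toFun w := (fun l i => w l (Fin.castAdd b i), fun l i => w l (Fin.natAdd a i))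
  invFun w := fun l => Fin.append (w.1 l) (w.2 l)
  left_inv w := by
    funext l i
    refine Fin.addCases (fun i => ?_) (fun i => ?_) i <;> simp
  right_inv w := by
    ext <;> simp

/-- Splitting a length-`(a + b)` sequence into its initial and final parts. -/
def seqSplitEquiv (W : Type*) (a b : ℕ) :
    (Fin (a + b) → W) ≃ (Fin a → W) × (Fin b → W) :=
  (Fin.appendEquiv a b).symm

theorem seqSplitEquiv_apply (W : Type*) (a b : ℕ) (w : Fin (a + b) → W) :
    seqSplitEquiv W a b w = (fun i => w (Fin.castAdd b i), fun i => w (Fin.natAdd a i)) :=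
  rfl

section Induced

variable {L : ℕ} {U X Y : Fin L → Type} {V Z : Type}

/-- The encoder that does not use the channel. -/
def silentEncoder (U X : Fin L → Type) (k : ℕ) :
    (l : Fin L) → (Fin k → U l) → (Fin 0 → X l) → ℝ :=
  fun _ _ _ => 1

theorem isKernel_silentEncoder [∀ l, Fintype (X l)] (k : ℕ) (l : Fin L) : IsKernel (silentEncoder U X k l) := by
  refine fun u => ⟨fun _ => zero_le_one, ?_⟩
  simp [silentEncoder]

theorem sum_channel_prod [∀ l, Fintype (Y l)] {Ch : (l : Fin L) → X l → Y l → ℝ} (hCh : ∀ l, IsKernel (Ch l)) {n : ℕ}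
    (x : (l : Fin L) → Fin n → X l) :
    ∑ y : (l : Fin L) → Fin n → Y l, ∏ l, ∏ j : Fin n, Ch l (x l j) (y l j) = 1 := by
  classical
  have h := Fintype.prod_sum (fun l (y : Fin n → Y l) => ∏ j : Fin n, Ch l (x l j) (y j))
  rw [← h]
  refine Finset.prod_eq_one fun l _ => ?_
  rw [← Fintype.prod_sum (fun j (y : Y l) => Ch l (x l j) y)]
  exact Finset.prod_eq_one fun j _ => (hCh l _).2

/-- Concatenation of two block encoders. -/
def concatEncoder {k₁ n₁ k₂ n₂ : ℕ}
    (f₁ : (l : Fin L) → (Fin k₁ → U l) → (Fin n₁ → X l) → ℝ)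
    (f₂ : (l : Fin L) → (Fin k₂ → U l) → (Fin n₂ → X l) → ℝ) :
    (l : Fin L) → (Fin (k₁ + k₂) → U l) → (Fin (n₁ + n₂) → X l) → ℝ :=
  fun l u x =>
    f₁ l (fun i => u (Fin.castAdd k₂ i)) (fun j => x (Fin.castAdd n₂ j)) *
      f₂ l (fun i => u (Fin.natAdd k₁ i)) (fun j => x (Fin.natAdd n₁ j))

theorem isKernel_concatEncoder [∀ l, Fintype (X l)] {k₁ n₁ k₂ n₂ : ℕ}
    {f₁ : (l : Fin L) → (Fin k₁ → U l) → (Fin n₁ → X l) → ℝ}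
    {f₂ : (l : Fin L) → (Fin k₂ → U l) → (Fin n₂ → X l) → ℝ}
    (h₁ : ∀ l, IsKernel (f₁ l)) (h₂ : ∀ l, IsKernel (f₂ l)) (l : Fin L) :
    IsKernel (concatEncoder f₁ f₂ l) := by
  refine fun u => ⟨fun x => mul_nonneg ((h₁ l _).1 _) ((h₂ l _).1 _), ?_⟩
  have h := congrArg₂ (· * ·) (h₁ l fun i => u (Fin.castAdd k₂ i)).2
    (h₂ l fun i => u (Fin.natAdd k₁ i)).2
  simp only [Finset.sum_mul_sum, mul_one] at h
  rw [← Fintype.sum_prod_type'] at h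
  rw [← h]
  exact Fintype.sum_equiv (seqSplitEquiv (X l) n₁ n₂) _ _ fun _ => rfl

variable [∀ l, Fintype (U l)] [∀ l, Fintype (X l)]

theorem inducedDist_concatEncoder (P : (((l : Fin L) → U l) × V × Z) → ℝ)
    (Ch : (l : Fin L) → X l → Y l → ℝ) {k₁ n₁ k₂ n₂ : ℕ}
    (f₁ : (l : Fin L) → (Fin k₁ → U l) → (Fin n₁ → X l) → ℝ)
    (f₂ : (l : Fin L) → (Fin k₂ → U l) → (Fin n₂ → X l) → ℝ)
    (y : (l : Fin L) → Fin (n₁ + n₂) → Y l) (v : Fin (k₁ + k₂) → V) (z : Fin (k₁ + k₂) → Z) :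
    inducedDist P Ch (k₁ + k₂) (n₁ + n₂) (concatEncoder f₁ f₂) (y, v, z) =
      inducedDist P Ch k₁ n₁ f₁ ((splitEquiv Y n₁ n₂ y).1, (seqSplitEquiv V k₁ k₂ v).1,
          (seqSplitEquiv Z k₁ k₂ z).1) *
        inducedDist P Ch k₂ n₂ f₂ ((splitEquiv Y n₁ n₂ y).2, (seqSplitEquiv V k₁ k₂ v).2,
          (seqSplitEquiv Z k₁ k₂ z).2) := by
  unfold inducedDist
  rw [Finset.sum_mul_sum]
  refine Eq.trans ?_ (Fintype.sum_prod_type' _)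
  refine Fintype.sum_equiv (splitEquiv U k₁ k₂) _ _ fun u => ?_
  rw [Finset.sum_mul_sum, ← Fintype.sum_prod_type']
  refine Fintype.sum_equiv (splitEquiv X n₁ n₂) _ _ fun x => ?_
  simp only [Fin.prod_univ_add, concatEncoder, Finset.prod_mul_distrib, splitEquiv,
    seqSplitEquiv_apply, Equiv.coe_fn_mk]
  ring

/-- The joint pmf of `V^k` and the decoder's observations `(Y₁ⁿ,…,Y_Lⁿ,Z^k)`. -/
def decoderDist (P : (((l : Fin L) → U l) × V × Z) → ℝ)
    (Ch : (l : Fin L) → X l → Y l → ℝ) (k n : ℕ)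
    (f : (l : Fin L) → (Fin k → U l) → (Fin n → X l) → ℝ) :
    (Fin k → V) × (((l : Fin L) → Fin n → Y l) × (Fin k → Z)) → ℝ :=
  fun x => inducedDist P Ch k n f (x.2.1, x.1, x.2.2)

theorem decoderDist_concatEncoder (P : (((l : Fin L) → U l) × V × Z) → ℝ)
    (Ch : (l : Fin L) → X l → Y l → ℝ) {k₁ n₁ k₂ n₂ : ℕ}
    (f₁ : (l : Fin L) → (Fin k₁ → U l) → (Fin n₁ → X l) → ℝ)
    (f₂ : (l : Fin L) → (Fin k₂ → U l) → (Fin n₂ → X l) → ℝ)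
    (a : Fin (k₁ + k₂) → V) (b : ((l : Fin L) → Fin (n₁ + n₂) → Y l) × (Fin (k₁ + k₂) → Z)) :
    let eA := seqSplitEquiv V k₁ k₂
    let eB := ((splitEquiv Y n₁ n₂).prodCongr (seqSplitEquiv Z k₁ k₂)).trans
      (Equiv.prodProdProdComm _ _ _ _)
    decoderDist P Ch (k₁ + k₂) (n₁ + n₂) (concatEncoder f₁ f₂) (a, b) =
      decoderDist P Ch k₁ n₁ f₁ ((eA a).1, (eB b).1) *
        decoderDist P Ch k₂ n₂ f₂ ((eA a).2, (eB b).2) :=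
  inducedDist_concatEncoder P Ch f₁ f₂ b.1 a b.2

variable [∀ l, Fintype (Y l)] [Fintype V] [Fintype Z]

/-- Transposition of `k`-fold source sequences. -/
def sourceEquiv (U : Fin L → Type) (V Z : Type) (k : ℕ) :
    (Fin k → ((l : Fin L) → U l) × V × Z) ≃
      (((l : Fin L) → Fin k → U l) × (Fin k → V) × (Fin k → Z)) where
  toFun w := (fun l i => (w i).1 l, fun i => (w i).2.1, fun i => (w i).2.2)
  invFun w := fun i => (fun l => w.1 l i, w.2.1 i, w.2.2 i)
  left_inv _ := rfl
  right_inv _ := rfl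

theorem sum_source_prod {P : (((l : Fin L) → U l) × V × Z) → ℝ} (hP : IsPMF P) (k : ℕ) :
    ∑ w : ((l : Fin L) → Fin k → U l) × (Fin k → V) × (Fin k → Z),
      ∏ i : Fin k, P ((fun l => w.1 l i), w.2.1 i, w.2.2 i) = 1 := by
  classical
  rw [← Fintype.sum_equiv (sourceEquiv U V Z k) (fun w => ∏ i, P (w i)) _ fun _ => rfl,
    ← Fintype.prod_sum (fun (_ : Fin k) w => P w)]
  exact Finset.prod_eq_one fun _ _ => hP.2

theorem inducedDist_isPMF {P : (((l : Fin L) → U l) × V × Z) → ℝ} (hP : IsPMF P)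
    {Ch : (l : Fin L) → X l → Y l → ℝ} (hCh : ∀ l, IsKernel (Ch l)) {k n : ℕ}
    {f : (l : Fin L) → (Fin k → U l) → (Fin n → X l) → ℝ} (hf : ∀ l, IsKernel (f l)) :
    IsPMF (inducedDist P Ch k n f) := by
  classical
  refine ⟨fun w => Finset.sum_nonneg fun u _ => Finset.sum_nonneg fun x _ =>
    mul_nonneg (Finset.prod_nonneg fun i _ => hP.1 _)
      (mul_nonneg (Finset.prod_nonneg fun l _ => (hf l _).1 _)
        (Finset.prod_nonneg fun l _ => Finset.prod_nonneg fun j _ => (hCh l _).1 _)), ?_⟩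
  have henc : ∀ u : (l : Fin L) → Fin k → U l,
      ∑ x : (l : Fin L) → Fin n → X l, ∏ l, f l (u l) (x l) = 1 := by
    intro u
    rw [← Fintype.prod_sum (fun l x => f l (u l) x)]
    exact Finset.prod_eq_one fun l _ => (hf l _).2
  have hy : ∀ (u : (l : Fin L) → Fin k → U l) (vz : (Fin k → V) × (Fin k → Z)),
      ∑ y : (l : Fin L) → Fin n → Y l, ∑ x : (l : Fin L) → Fin n → X l,
        (∏ i : Fin k, P ((fun l => u l i), vz.1 i, vz.2 i)) *
          ((∏ l, f l (u l) (x l)) * ∏ l, ∏ j : Fin n, Ch l (x l j) (y l j)) =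
      ∏ i : Fin k, P ((fun l => u l i), vz.1 i, vz.2 i) := by
    intro u vz
    rw [Finset.sum_comm]
    simp only [← Finset.mul_sum, sum_channel_prod hCh, mul_one, henc]
  unfold inducedDist
  rw [Fintype.sum_prod_type_right, ← sum_source_prod hP k]
  refine Eq.trans ?_ (Fintype.sum_prod_type_right _).symm
  refine Finset.sum_congr rfl fun vz _ => ?_
  rw [Finset.sum_comm]
  exact Finset.sum_congr rfl fun u _ => hy u vz

/-- Moving the source sequence in front of the decoder's observations. -/
def swapFront (A B C : Type*) : A × B × C ≃ B × A × C where
  toFun x := (x.2.1, x.1, x.2.2)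
  invFun x := (x.2.1, x.1, x.2.2)
  left_inv _ := rfl
  right_inv _ := rfl

theorem decoderDist_isPMF {P : (((l : Fin L) → U l) × V × Z) → ℝ} (hP : IsPMF P)
    {Ch : (l : Fin L) → X l → Y l → ℝ} (hCh : ∀ l, IsKernel (Ch l)) {k n : ℕ}
    {f : (l : Fin L) → (Fin k → U l) → (Fin n → X l) → ℝ} (hf : ∀ l, IsKernel (f l)) :
    IsPMF (decoderDist P Ch k n f) := by
  have h := inducedDist_isPMF hP hCh hf
  refine ⟨fun x => h.1 _, ?_⟩
  rw [← h.2]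
  exact Fintype.sum_equiv (swapFront _ _ _) _ _ fun _ => rfl

theorem probCorrect_eq_sum_decoderDist (P : (((l : Fin L) → U l) × V × Z) → ℝ)
    (Ch : (l : Fin L) → X l → Y l → ℝ) (k n m : ℕ)
    (f : (l : Fin L) → (Fin k → U l) → (Fin n → X l) → ℝ)
    (φ : (Fin k → V) → Fin m)
    (g : Fin m × ((l : Fin L) → Fin n → Y l) × (Fin k → Z) → (Fin k → V)) :
    probCorrect P Ch k n m f φ g =
      ∑ x, ind (g (φ x.1, x.2) = x.1) * decoderDist P Ch k n f x :=
  Fintype.sum_equiv (swapFront _ _ _) _ _ fun _ => rfl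

theorem condEntV_eq (P : (((l : Fin L) → U l) × V × Z) → ℝ)
    (Ch : (l : Fin L) → X l → Y l → ℝ) (k n : ℕ)
    (f : (l : Fin L) → (Fin k → U l) → (Fin n → X l) → ℝ) :
    condEntV P Ch k n f = condEntropy (decoderDist P Ch k n f) :=
  rfl

/-- Repeating a block encoder gives encoders of every block length whose information density
has mean close to `k` times the normalized conditional entropy and linearly growing variance. -/
theorem exists_repeated_encoder {P : (((l : Fin L) → U l) × V × Z) → ℝ} (hP : IsPMF P)
    {Ch : (l : Fin L) → X l → Y l → ℝ} (hCh : ∀ l, IsKernel (Ch l)) {τ : ℝ} (hτ : 0 < τ)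
    {k₀ n₀ : ℕ} (hk₀ : 1 ≤ k₀) (hn₀ : (n₀ : ℝ) ≤ τ * k₀)
    {f₀ : (l : Fin L) → (Fin k₀ → U l) → (Fin n₀ → X l) → ℝ} (hf₀ : ∀ l, IsKernel (f₀ l)) :
    ∃ C : ℝ, 0 ≤ C ∧ ∀ k : ℕ, ∃ n : ℕ, (n : ℝ) ≤ τ * k ∧
      ∃ f : (l : Fin L) → (Fin k → U l) → (Fin n → X l) → ℝ, (∀ l, IsKernel (f l)) ∧
        condEntropy (decoderDist P Ch k n f) ≤ k * (condEntV P Ch k₀ n₀ f₀ / k₀) + C ∧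
        infoVar (decoderDist P Ch k n f) ≤ C * (k + 1) := by
  have hk₀' : (0 : ℝ) < k₀ := by exact_mod_cast hk₀
  have hD₀ := decoderDist_isPMF hP hCh hf₀
  have hH₀ : 0 ≤ condEntV P Ch k₀ n₀ f₀ := condEntropy_nonneg hD₀.1
  set s : ℕ → ℝ := fun r => condEntropy (decoderDist P Ch r 0 (silentEncoder U X r)) +
    infoVar (decoderDist P Ch r 0 (silentEncoder U X r)) with hs
  have hent : ∀ r, 0 ≤ condEntropy (decoderDist P Ch r 0 (silentEncoder U X r)) := fun r =>
    condEntropy_nonneg (decoderDist_isPMF hP hCh (isKernel_silentEncoder r)).1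
  have hvar : ∀ r, 0 ≤ infoVar (decoderDist P Ch r 0 (silentEncoder U X r)) := fun r =>
    infoVar_nonneg (decoderDist_isPMF hP hCh (isKernel_silentEncoder r)).1
  have hs0 : ∀ r, 0 ≤ s r := fun r => add_nonneg (hent r) (hvar r)
  have hv₀ := infoVar_nonneg hD₀.1
  have hS0 : 0 ≤ ∑ r ∈ Finset.range k₀, s r := Finset.sum_nonneg fun r _ => hs0 r
  set C : ℝ := ∑ r ∈ Finset.range k₀, s r + infoVar (decoderDist P Ch k₀ n₀ f₀) with hC
  have hC0 : 0 ≤ C := add_nonneg hS0 hv₀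
  refine ⟨C, hC0, fun k => ?_⟩
  induction k using Nat.strong_induction_on with
  | _ k ih =>
    rcases lt_or_ge k k₀ with hk | hk
    · have hsk : s k ≤ C :=
        (Finset.single_le_sum (f := s) (fun r _ => hs0 r) (Finset.mem_range.2 hk)).trans
          (le_add_of_nonneg_right hv₀)
      refine ⟨0, by simpa using mul_nonneg hτ.le k.cast_nonneg, silentEncoder U X k,
        isKernel_silentEncoder k, ?_, ?_⟩
      · have : 0 ≤ (k : ℝ) * (condEntV P Ch k₀ n₀ f₀ / k₀) := by positivity
        linarith [hvar k]
      · have : 0 ≤ C * (k : ℝ) := by positivity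
        linarith [hent k]
    · obtain ⟨k', rfl⟩ := Nat.exists_eq_add_of_le' hk
      obtain ⟨n, hn, f, hf, hmean, hvar'⟩ := ih k' (by omega)
      have hD := decoderDist_isPMF hP hCh hf
      refine ⟨n + n₀, by push_cast; linarith, concatEncoder f f₀, isKernel_concatEncoder hf hf₀,
        ?_, ?_⟩
      · rw [condEntropy_of_product hD hD₀ (decoderDist_concatEncoder P Ch f f₀),
          ← condEntV_eq P Ch k₀]
        push_cast
        have : (k₀ : ℝ) * (condEntV P Ch k₀ n₀ f₀ / k₀) = condEntV P Ch k₀ n₀ f₀ := by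
          field_simp
        linarith
      · rw [infoVar_of_product hD hD₀ (decoderDist_concatEncoder P Ch f f₀)]
        push_cast
        have h1 : (1 : ℝ) ≤ k₀ := by exact_mod_cast hk₀
        have h2 : C ≤ C * k₀ := le_mul_of_one_le_right hC0 h1
        linarith

/-- Sending the whole source over the noiseless link. -/
theorem exists_trivial_code [Nonempty V] {P : (((l : Fin L) → U l) × V × Z) → ℝ} (hP : IsPMF P)
    {Ch : (l : Fin L) → X l → Y l → ℝ} (hCh : ∀ l, IsKernel (Ch l)) (k : ℕ) :
    ∃ (φ : (Fin k → V) → Fin (Fintype.card V ^ k))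
      (g : Fin (Fintype.card V ^ k) × ((l : Fin L) → Fin 0 → Y l) × (Fin k → Z) → (Fin k → V)),
      probCorrect P Ch k 0 (Fintype.card V ^ k) (silentEncoder U X k) φ g = 1 := by
  classical
  have e : (Fin k → V) ≃ Fin (Fintype.card V ^ k) := Fintype.equivFinOfCardEq (by simp)
  refine ⟨e, fun y => e.symm y.1, ?_⟩
  rw [probCorrect_eq_sum_decoderDist, ← (decoderDist_isPMF hP hCh (isKernel_silentEncoder k)).2]
  refine Finset.sum_congr rfl fun x _ => ?_
  rw [ind_of_true (e.symm_apply_apply _), one_mul]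

theorem exists_code_of_infoVar [Nonempty V] {P : (((l : Fin L) → U l) × V × Z) → ℝ}
    (hP : IsPMF P) {Ch : (l : Fin L) → X l → Y l → ℝ} (hCh : ∀ l, IsKernel (Ch l)) {k n : ℕ}
    {f : (l : Fin L) → (Fin k → U l) → (Fin n → X l) → ℝ} (hf : ∀ l, IsKernel (f l))
    {m : ℕ} (hm : 0 < m) {c t : ℝ} (ht : 0 < t)
    (hc : condEntropy (decoderDist P Ch k n f) ≤ c) :
    ∃ (φ : (Fin k → V) → Fin m)
      (g : Fin m × ((l : Fin L) → Fin n → Y l) × (Fin k → Z) → (Fin k → V)),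
      1 - (infoVar (decoderDist P Ch k n f) / t ^ 2 + (2 : ℝ) ^ (c + t) / m) ≤
        probCorrect P Ch k n m f φ g := by
  have hD := decoderDist_isPMF hP hCh hf
  obtain ⟨φ, g, h⟩ := exists_binning hD hm (T := (2 : ℝ) ^ (c + t)) (by positivity)
  refine ⟨φ, g, ?_⟩
  rw [probCorrect_eq_sum_decoderDist]
  have := sum_ind_lt_le_infoVar hD.1 ht hc
  linarith

theorem eventually_exists_code [Nonempty V] {P : (((l : Fin L) → U l) × V × Z) → ℝ}
    (hP : IsPMF P) {Ch : (l : Fin L) → X l → Y l → ℝ} (hCh : ∀ l, IsKernel (Ch l))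
    {τ : ℝ} (hτ : 0 < τ) {k₀ n₀ : ℕ} (hk₀ : 1 ≤ k₀) (hn₀ : (n₀ : ℝ) ≤ τ * k₀)
    {f₀ : (l : Fin L) → (Fin k₀ → U l) → (Fin n₀ → X l) → ℝ} (hf₀ : ∀ l, IsKernel (f₀ l))
    {ε lam : ℝ} (hε : 0 < ε) (hlam : 0 < lam) :
    ∀ᶠ k : ℕ in atTop, ∃ (n m : ℕ) (f : (l : Fin L) → (Fin k → U l) → (Fin n → X l) → ℝ)
      (φ : (Fin k → V) → Fin m)
      (g : Fin m × ((l : Fin L) → Fin n → Y l) × (Fin k → Z) → (Fin k → V)),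
      (n : ℝ) ≤ τ * k ∧ 1 ≤ m ∧ (∀ l, IsKernel (f l)) ∧
        1 - lam ≤ probCorrect P Ch k n m f φ g ∧
        Real.logb 2 m / k ≤ condEntV P Ch k₀ n₀ f₀ / k₀ + ε := by
  obtain ⟨C, hC0, hC⟩ := exists_repeated_encoder hP hCh hτ hk₀ hn₀ hf₀
  set h : ℝ := condEntV P Ch k₀ n₀ f₀ / k₀ with hh
  have hh0 : 0 ≤ h :=
    div_nonneg (condEntropy_nonneg (decoderDist_isPMF hP hCh hf₀).1) k₀.cast_nonneg
  have hlim : Tendsto (fun k : ℕ => C * (k + 1) / (k * (ε / 4)) ^ 2 +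
      (2 : ℝ) ^ (C - k * (ε / 4))) atTop (nhds 0) := by
    have h1 : Tendsto (fun k : ℕ => (k : ℝ)⁻¹) atTop (nhds 0) := tendsto_inv_atTop_nhds_zero_nat
    have h2 : Tendsto (fun k : ℕ => C * (k + 1) / ((k : ℝ) * (ε / 4)) ^ 2) atTop (nhds 0) := by
      have h3 : Tendsto (fun k : ℕ => C / (ε / 4) ^ 2 * ((k : ℝ)⁻¹ + (k : ℝ)⁻¹ * (k : ℝ)⁻¹))
          atTop (nhds 0) := by
        simpa using (h1.add (h1.mul h1)).const_mul (C / (ε / 4) ^ 2)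
      refine h3.congr' ?_
      filter_upwards [eventually_ge_atTop 1] with k hk
      have : (k : ℝ) ≠ 0 := by positivity
      field_simp
    have h4 : Tendsto (fun k : ℕ => (2 : ℝ) ^ (C - k * (ε / 4))) atTop (nhds 0) := by
      have h5 : Tendsto (fun k : ℕ => (k : ℝ) * (ε / 4)) atTop atTop :=
        tendsto_natCast_atTop_atTop.atTop_mul_const (by positivity)
      have h6 : Tendsto (fun k : ℕ => C - (k : ℝ) * (ε / 4)) atTop atBot :=
        tendsto_atBot_add_const_left _ C (tendsto_neg_atTop_atBot.comp h5)
      exact (tendsto_rpow_atBot_of_base_gt_one 2 one_lt_two).comp h6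
    simpa using h2.add h4
  have hbig : ∀ᶠ k : ℕ in atTop, 2 / ε ≤ (k : ℝ) :=
    tendsto_natCast_atTop_atTop.eventually_ge_atTop _
  filter_upwards [hlim.eventually_lt_const hlam, hbig, eventually_ge_atTop 1] with k hk hkε hk1
  have hk0 : (0 : ℝ) < k := by exact_mod_cast hk1
  obtain ⟨n, hn, f, hf, hmean, hvar⟩ := hC k
  set x : ℝ := (2 : ℝ) ^ (k * h + k * (ε / 2)) with hx
  have hx1 : 1 ≤ x := Real.one_le_rpow one_le_two (by positivity)
  have hm : 0 < ⌈x⌉₊ := Nat.ceil_pos.2 (by positivity)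
  obtain ⟨φ, g, hφg⟩ := exists_code_of_infoVar hP hCh hf hm (t := k * (ε / 4)) (by positivity) hmean
  refine ⟨n, ⌈x⌉₊, f, φ, g, hn, hm, hf, ?_, ?_⟩
  · have h1 : infoVar (decoderDist P Ch k n f) / (k * (ε / 4)) ^ 2 ≤
        C * (k + 1) / (k * (ε / 4)) ^ 2 := div_le_div_of_nonneg_right hvar (sq_nonneg _)
    have h2 : (2 : ℝ) ^ (k * h + C + k * (ε / 4)) / ⌈x⌉₊ ≤ (2 : ℝ) ^ (C - k * (ε / 4)) := by
      calc (2 : ℝ) ^ (k * h + C + k * (ε / 4)) / ⌈x⌉₊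
          ≤ (2 : ℝ) ^ (k * h + C + k * (ε / 4)) / x :=
            div_le_div_of_nonneg_left (by positivity) (by positivity) (Nat.le_ceil x)
        _ = (2 : ℝ) ^ (C - k * (ε / 4)) := by
            rw [hx, ← Real.rpow_sub two_pos]; congr 1; ring
    linarith
  · have h1 : (⌈x⌉₊ : ℝ) ≤ 2 * x := by linarith [Nat.ceil_lt_add_one (zero_le_one.trans hx1)]
    have h2 := Real.logb_le_logb_of_le one_lt_two (by exact_mod_cast hm) h1
    rw [Real.logb_mul two_ne_zero (by positivity), Real.logb_self_eq_one one_lt_two, hx,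
      Real.logb_rpow two_pos (by norm_num)] at h2
    rw [div_le_iff₀ hk0]
    rw [div_le_iff₀ hε] at hkε
    linarith

theorem jsccAchievable_of_lt [Nonempty V] {P : (((l : Fin L) → U l) × V × Z) → ℝ}
    (hP : IsPMF P) {Ch : (l : Fin L) → X l → Y l → ℝ} (hCh : ∀ l, IsKernel (Ch l))
    {τ : ℝ} (hτ : 0 < τ) {k₀ n₀ : ℕ} (hk₀ : 1 ≤ k₀) (hn₀ : (n₀ : ℝ) ≤ τ * k₀)
    {f₀ : (l : Fin L) → (Fin k₀ → U l) → (Fin n₀ → X l) → ℝ} (hf₀ : ∀ l, IsKernel (f₀ l))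
    {ε : ℝ} (hε : 0 < ε) :
    JSCCAchievable P Ch τ (condEntV P Ch k₀ n₀ f₀ / k₀ + ε) := by
  intro lam hlam _
  obtain ⟨K, hK⟩ := eventually_atTop.1 (eventually_exists_code hP hCh hτ hk₀ hn₀ hf₀ hε hlam)
  set h : ℝ := condEntV P Ch k₀ n₀ f₀ / k₀ with hh
  have hh0 : 0 ≤ h :=
    div_nonneg (condEntropy_nonneg (decoderDist_isPMF hP hCh hf₀).1) k₀.cast_nonneg
  have hV : 1 ≤ Fintype.card V := Fintype.card_pos
  have hlV : 0 ≤ Real.logb 2 (Fintype.card V) := Real.logb_nonneg one_lt_two (by exact_mod_cast hV)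
  set δ : ℕ → ℝ := fun k => if K ≤ k then 0 else Real.logb 2 (Fintype.card V) with hδ
  have hcode : ∀ k : ℕ, ∃ (n m : ℕ) (f : (l : Fin L) → (Fin k → U l) → (Fin n → X l) → ℝ)
      (φ : (Fin k → V) → Fin m)
      (g : Fin m × ((l : Fin L) → Fin n → Y l) × (Fin k → Z) → (Fin k → V)), 1 ≤ k →
      (n : ℝ) ≤ τ * k ∧ 1 ≤ m ∧ (∀ l, IsKernel (f l)) ∧
        1 - lam ≤ probCorrect P Ch k n m f φ g ∧ Real.logb 2 m / k ≤ h + ε + δ k := by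
    intro k
    by_cases hk : K ≤ k
    · obtain ⟨n, m, f, φ, g, h1, h2, h3, h4, h5⟩ := hK k hk
      exact ⟨n, m, f, φ, g, fun _ => ⟨h1, h2, h3, h4, by simpa [hδ, hk] using h5⟩⟩
    · obtain ⟨φ, g, hφg⟩ := exists_trivial_code hP hCh k
      refine ⟨0, _, silentEncoder U X k, φ, g, fun hk1 => ⟨?_, Nat.one_le_pow _ _ hV,
        isKernel_silentEncoder k, by rw [hφg]; linarith, ?_⟩⟩
      · simpa using mul_nonneg hτ.le k.cast_nonneg
      · have hk0 : (0 : ℝ) < k := by exact_mod_cast hk1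
        simp only [hδ, if_neg hk]
        rw [Nat.cast_pow, Real.logb_pow, mul_div_cancel_left₀ _ hk0.ne']
        linarith
  choose n m f φ g hall using hcode
  refine ⟨n, m, δ, f, φ, g, fun k => ?_, ?_, hall⟩
  · simp only [hδ]; split_ifs
    · exact le_rfl
    · exact hlV
  · refine tendsto_const_nhds.congr' ?_
    filter_upwards [eventually_ge_atTop K] with k hk
    simp [hδ, hk]

theorem zero_mem_lowerBounds_Rk {P : (((l : Fin L) → U l) × V × Z) → ℝ} (hP : IsPMF P)
    {Ch : (l : Fin L) → X l → Y l → ℝ} (hCh : ∀ l, IsKernel (Ch l)) (τ : ℝ) (k : ℕ) :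
    0 ∈ lowerBounds {r | ∃ n : ℕ, (n : ℝ) ≤ τ * k ∧
      ∃ f : (l : Fin L) → (Fin k → U l) → (Fin n → X l) → ℝ,
        (∀ l, IsKernel (f l)) ∧ r = condEntV P Ch k n f / k} := by
  rintro r ⟨n, -, f, hf, rfl⟩
  exact div_nonneg (condEntropy_nonneg (decoderDist_isPMF hP hCh hf).1) k.cast_nonneg

theorem Rk_nonneg {P : (((l : Fin L) → U l) × V × Z) → ℝ} (hP : IsPMF P)
    {Ch : (l : Fin L) → X l → Y l → ℝ} (hCh : ∀ l, IsKernel (Ch l)) (τ : ℝ) (k : ℕ) :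
    0 ≤ Rk P Ch τ k :=
  Real.sInf_nonneg fun _ hr => zero_mem_lowerBounds_Rk hP hCh τ k hr

theorem jsccAchievable_nonneg {P : (((l : Fin L) → U l) × V × Z) → ℝ}
    {Ch : (l : Fin L) → X l → Y l → ℝ} {τ R : ℝ} (h : JSCCAchievable P Ch τ R) : 0 ≤ R := by
  obtain ⟨n, m, δ, f, φ, g, -, hδ, hall⟩ := h 1 one_pos le_rfl
  have hlim : Tendsto (fun k => R + δ k) atTop (nhds R) := by simpa using hδ.const_add R
  refine ge_of_tendsto hlim ?_
  filter_upwards [eventually_ge_atTop 1] with k hk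
  obtain ⟨-, hm, -, -, hR⟩ := hall k hk
  exact (div_nonneg (Real.logb_nonneg one_lt_two (by exact_mod_cast hm)) k.cast_nonneg).trans hR

theorem sInf_Rk_le_of_jsccAchievable [Nonempty V] {P : (((l : Fin L) → U l) × V × Z) → ℝ}
    (hP : IsPMF P) {Ch : (l : Fin L) → X l → Y l → ℝ} (hCh : ∀ l, IsKernel (Ch l))
    {τ R : ℝ} (h : JSCCAchievable P Ch τ R) :
    sInf {r | ∃ k : ℕ, 1 ≤ k ∧ r = Rk P Ch τ k} ≤ R := by
  set I : ℝ := sInf {r | ∃ k : ℕ, 1 ≤ k ∧ r = Rk P Ch τ k} with hI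
  have hbdd : BddBelow {r | ∃ k : ℕ, 1 ≤ k ∧ r = Rk P Ch τ k} := by
    refine ⟨0, ?_⟩
    rintro r ⟨k, -, rfl⟩
    exact Rk_nonneg hP hCh τ k
  have hlam : ∀ lam : ℝ, 0 < lam → lam ≤ 1 →
      I ≤ R + lam * Real.logb 2 (Fintype.card V) := by
    intro lam h0 h1
    obtain ⟨n, m, δ, f, φ, g, -, hδ, hall⟩ := h lam h0 h1
    have hlim : Tendsto (fun k : ℕ => R + δ k + (k : ℝ)⁻¹ + lam * Real.logb 2 (Fintype.card V))
        atTop (nhds (R + lam * Real.logb 2 (Fintype.card V))) := by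
      simpa using ((hδ.const_add R).add tendsto_inv_atTop_nhds_zero_nat).add_const
        (lam * Real.logb 2 (Fintype.card V))
    refine ge_of_tendsto hlim ?_
    filter_upwards [eventually_ge_atTop 1] with k hk
    obtain ⟨hn, hm, hf, hprob, hrate⟩ := hall k hk
    have hk0 : (0 : ℝ) < k := by exact_mod_cast hk
    rw [probCorrect_eq_sum_decoderDist] at hprob
    have hfano := condEntropy_le_of_code (decoderDist_isPMF hP hCh hf) hm (φ k) (g k) hprob
    rw [Fintype.card_fun, Fintype.card_fin, Nat.cast_pow, Real.logb_pow] at hfano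
    calc I ≤ Rk P Ch τ k := csInf_le hbdd ⟨k, hk, rfl⟩
      _ ≤ condEntV P Ch k (n k) (f k) / k :=
          csInf_le ⟨0, zero_mem_lowerBounds_Rk hP hCh τ k⟩ ⟨n k, hn, f k, hf, rfl⟩
      _ ≤ (Real.logb 2 (m k) + 1 + lam * (k * Real.logb 2 (Fintype.card V))) / k :=
          div_le_div_of_nonneg_right hfano hk0.le
      _ = Real.logb 2 (m k) / k + (k : ℝ)⁻¹ + lam * Real.logb 2 (Fintype.card V) := by
          field_simp
      _ ≤ _ := by linarith
  have hlim : Tendsto (fun lam : ℝ => R + lam * Real.logb 2 (Fintype.card V))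
      (nhdsWithin 0 (Set.Ioi 0)) (nhds R) := by
    refine Tendsto.mono_left ?_ nhdsWithin_le_nhds
    have : Continuous fun lam : ℝ => R + lam * Real.logb 2 (Fintype.card V) := by fun_prop
    simpa using this.tendsto 0
  refine ge_of_tendsto hlim ?_
  filter_upwards [Ioc_mem_nhdsGT (zero_lt_one' ℝ)] with lam hl
  exact hlam lam hl.1 hl.2

end Induced

end DHT

open DHT Filter Real

/-- For the `L`-helper JSCC problem with bandwidth ratio `τ > 0`,
`R(τ) = inf_{k ≥ 1} R_k`. -/
theorem statement_6 {L : ℕ} {U X Y : Fin L → Type} {V Z : Type}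
    [∀ l, Fintype (U l)] [∀ l, Fintype (X l)] [∀ l, Fintype (Y l)]
    [Fintype V] [Fintype Z]
    (P : (((l : Fin L) → U l) × V × Z) → ℝ) (hP : IsPMF P)
    (Ch : (l : Fin L) → X l → Y l → ℝ) (hCh : ∀ l, IsKernel (Ch l))
    (τ : ℝ) (hτ : 0 < τ) :
    Rjscc P Ch τ = sInf {r | ∃ k : ℕ, 1 ≤ k ∧ r = Rk P Ch τ k} := by
  have : Nonempty V := by
    by_contra hV
    rw [not_nonempty_iff] at hV
    simpa using hP.2
  have hsilent : ∀ k : ℕ, ((0 : ℕ) : ℝ) ≤ τ * k := fun k => by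
    simpa using mul_nonneg hτ.le k.cast_nonneg
  have hach : ∀ R, JSCCAchievable P Ch τ R → sInf {r | ∃ k : ℕ, 1 ≤ k ∧ r = Rk P Ch τ k} ≤ R :=
    fun R hR => sInf_Rk_le_of_jsccAchievable hP hCh hR
  refine le_antisymm ?_ ?_
  · refine le_csInf ⟨_, 1, le_rfl, rfl⟩ ?_
    rintro r ⟨k, hk, rfl⟩
    refine le_csInf ⟨_, 0, hsilent k, silentEncoder U X k, isKernel_silentEncoder k, rfl⟩ ?_
    rintro r ⟨n, hn, f, hf, rfl⟩
    refine le_of_forall_pos_le_add fun ε hε => ?_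
    exact csInf_le ⟨0, fun R hR => jsccAchievable_nonneg hR⟩
      (jsccAchievable_of_lt hP hCh hτ hk hn hf hε)
  · exact le_csInf ⟨_, jsccAchievable_of_lt hP hCh hτ le_rfl (hsilent 1)
      (isKernel_silentEncoder 1) one_pos⟩ hach
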